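/- Let k ≥ 2, d ≥ 1, and ℓ ≥ 2 be integers with (ℓ-1)d ≥ k. For all nonnegative functions f_1, …, f_ℓ : ℤ^d → [0,∞) and all x ∈ ℤ^d, the ℓ-linear degree-k discrete spherical maximal operator satisfies the pointwise product bound T^{k,ℓ,*}(f_1,…,f_ℓ)(x) ≤ M_k f_1(x) · S_k^{ℓ-1}(f_2,…,f_ℓ)(x), where M_k is the discrete Hardy–Littlewood maximal operator over k-balls and S_k^{ℓ-1} is the (ℓ-1)-linear degree-k discrete spherical maximal operator. -/

import Mathlib

open scoped ENNReal NNReal BigOperators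

noncomputable section

/-- `|u|_k^k = ∑ j, |u j| ^ k` for `u ∈ ℤ^d`. -/
def normK {d : ℕ} (k : ℕ) (u : Fin d → ℤ) : ℤ := ∑ j, |u j| ^ k

/-- The `ℓ`-linear degree-`k` discrete spherical maximal operator on nonnegative functions:
`T^{k,ℓ,*}(f_1,…,f_ℓ)(x) = sup_{λ ≥ 1} λ^{-(ℓd/k-1)} ∑_{|u_1|_k^k+⋯+|u_ℓ|_k^k=λ}
f_1(x-u_1)⋯f_ℓ(x-u_ℓ)`, valued in `ℝ≥0∞`. -/
def multMaxKNN (d k l : ℕ) (f : Fin l → (Fin d → ℤ) → ℝ≥0) (x : Fin d → ℤ) : ℝ≥0∞ :=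
  ⨆ (lam : ℕ) (_ : 1 ≤ lam),
    ((lam : ℝ≥0∞) ^ ((((l * d : ℕ) : ℝ)) / (k : ℝ) - 1))⁻¹ *
      ∑' u : {u : Fin l → Fin d → ℤ // ∑ i, normK k (u i) = (lam : ℤ)},
        ∏ i, (f i (x - u.1 i) : ℝ≥0∞)

/-- The discrete Hardy–Littlewood maximal operator over `k`-balls:
`M_k f(x) = sup_{λ ≥ 1} λ^{-d/k} ∑_{|u|_k^k ≤ λ} f(x-u)`. -/
def hlMaxK (d k : ℕ) (f : (Fin d → ℤ) → ℝ≥0) (x : Fin d → ℤ) : ℝ≥0∞ :=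
  ⨆ (lam : ℕ) (_ : 1 ≤ lam),
    ((lam : ℝ≥0∞) ^ ((d : ℝ) / (k : ℝ)))⁻¹ *
      ∑' u : {u : Fin d → ℤ // normK k u ≤ (lam : ℤ)}, (f (x - u.1) : ℝ≥0∞)

/-- The `m`-linear degree-`k` discrete spherical maximal operator (including the degenerate
sphere `μ = 0`, accounted for by the product term). -/
def multSphMaxKNN (d k m : ℕ) (g : Fin m → (Fin d → ℤ) → ℝ≥0) (x : Fin d → ℤ) : ℝ≥0∞ :=
  max (∏ i, (g i x : ℝ≥0∞))
    (⨆ (μ : ℕ) (_ : 1 ≤ μ),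
      ((μ : ℝ≥0∞) ^ ((((m * d : ℕ) : ℝ)) / (k : ℝ) - 1))⁻¹ *
        ∑' v : {v : Fin m → Fin d → ℤ // ∑ i, normK k (v i) = (μ : ℤ)},
          ∏ i, (g i (x - v.1 i) : ℝ≥0∞))

theorem normK_nonneg {d : ℕ} (k : ℕ) (u : Fin d → ℤ) : 0 ≤ normK k u :=
  Finset.sum_nonneg fun _ _ => pow_nonneg (abs_nonneg _) _

theorem normK_eq_zero {d k : ℕ} (hk : k ≠ 0) {u : Fin d → ℤ} : normK k u = 0 ↔ u = 0 := by
  rw [normK, Finset.sum_eq_zero_iff_of_nonneg fun _ _ => pow_nonneg (abs_nonneg _) _]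
  simp [hk, funext_iff]

theorem sum_normK_eq_zero {d k m : ℕ} (hk : k ≠ 0) {v : Fin m → Fin d → ℤ} :
    ∑ i, normK k (v i) = 0 ↔ v = 0 := by
  rw [Finset.sum_eq_zero_iff_of_nonneg fun _ _ => normK_nonneg _ _]
  simp [normK_eq_zero hk, funext_iff]

theorem ENNReal.inv_natCast_rpow_mul_le_iff {n : ℕ} (hn : 1 ≤ n) (e : ℝ) {a b : ℝ≥0∞} :
    ((n : ℝ≥0∞) ^ e)⁻¹ * a ≤ b ↔ a ≤ (n : ℝ≥0∞) ^ e * b := by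
  have h0 : (n : ℝ≥0∞) ≠ 0 := by exact_mod_cast (by omega : n ≠ 0)
  exact ENNReal.inv_mul_le_iff (ENNReal.rpow_pos (pos_iff_ne_zero.2 h0) (by simp)).ne'
    (ENNReal.rpow_ne_top_of_ne_zero h0 (by simp))

/-- The sum over the `k`-ball of radius `lam` is controlled by the maximal operator. -/
theorem tsum_ball_le_hlMaxK {d k lam : ℕ} (hlam : 1 ≤ lam) (f : (Fin d → ℤ) → ℝ≥0)
    (x : Fin d → ℤ) :
    ∑' u : {u : Fin d → ℤ // normK k u ≤ (lam : ℤ)}, (f (x - u.1) : ℝ≥0∞) ≤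
      (lam : ℝ≥0∞) ^ ((d : ℝ) / (k : ℝ)) * hlMaxK d k f x := by
  rw [← ENNReal.inv_natCast_rpow_mul_le_iff hlam]
  exact le_iSup₂_of_le lam hlam le_rfl

/-- The sum over any sphere with `μ ≤ lam`, including `μ = 0`, is controlled by the spherical
maximal operator. -/
theorem tsum_sphere_le_multSphMaxKNN {d k m μ lam : ℕ} (hk : k ≠ 0) (hmd : k ≤ m * d)
    (hlam : 1 ≤ lam) (hμ : μ ≤ lam) (g : Fin m → (Fin d → ℤ) → ℝ≥0) (x : Fin d → ℤ) :
    ∑' v : {v : Fin m → Fin d → ℤ // ∑ i, normK k (v i) = (μ : ℤ)},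
        ∏ i, (g i (x - v.1 i) : ℝ≥0∞) ≤
      (lam : ℝ≥0∞) ^ (((m * d : ℕ) : ℝ) / (k : ℝ) - 1) * multSphMaxKNN d k m g x := by
  have he : 0 ≤ ((m * d : ℕ) : ℝ) / (k : ℝ) - 1 := by
    rw [sub_nonneg, one_le_div (by positivity)]
    exact_mod_cast hmd
  rcases Nat.eq_zero_or_pos μ with rfl | hpos
  · have hsub : ∀ v : {v : Fin m → Fin d → ℤ // ∑ i, normK k (v i) = ((0 : ℕ) : ℤ)},
        v = ⟨0, (sum_normK_eq_zero hk).2 rfl⟩ := fun v =>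
      Subtype.ext ((sum_normK_eq_zero hk).1 (by simpa using v.2))
    rw [tsum_eq_single _ fun v hv => absurd (hsub v) hv]
    have h1 : (1 : ℝ≥0∞) ≤ (lam : ℝ≥0∞) ^ (((m * d : ℕ) : ℝ) / (k : ℝ) - 1) :=
      ENNReal.one_rpow (((m * d : ℕ) : ℝ) / (k : ℝ) - 1) ▸
        ENNReal.rpow_le_rpow (by exact_mod_cast hlam) he
    refine le_trans ?_ (le_mul_of_one_le_left' h1)
    simp only [Pi.zero_apply, sub_zero]
    exact le_max_left _ _
  · calc _ ≤ (μ : ℝ≥0∞) ^ (((m * d : ℕ) : ℝ) / (k : ℝ) - 1) * multSphMaxKNN d k m g x := by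
          rw [← ENNReal.inv_natCast_rpow_mul_le_iff hpos]
          exact le_max_of_le_right (le_iSup₂_of_le μ hpos le_rfl)
      _ ≤ _ := by gcongr

/-- Slicing the sphere in `(ℤ^d)^(m+1)` along its first coordinate. -/
theorem tsum_sphere_cons_le {d k m lam : ℕ} (f : (Fin d → ℤ) → ℝ≥0)
    (g : Fin m → (Fin d → ℤ) → ℝ≥0) (x : Fin d → ℤ) :
    ∑' u : {u : Fin (m + 1) → Fin d → ℤ // ∑ i, normK k (u i) = (lam : ℤ)},
        ∏ i, ((Fin.cons f g : Fin (m + 1) → (Fin d → ℤ) → ℝ≥0) i (x - u.1 i) : ℝ≥0∞) ≤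
      ∑' a : {a : Fin d → ℤ // normK k a ≤ (lam : ℤ)}, (f (x - a.1) : ℝ≥0∞) *
        ∑' v : {v : Fin m → Fin d → ℤ //
          ∑ i, normK k (v i) = (((lam : ℤ) - normK k a.1).toNat : ℤ)},
          ∏ i, (g i (x - v.1 i) : ℝ≥0∞) := by
  simp_rw [← ENNReal.tsum_mul_left]
  rw [← ENNReal.tsum_sigma' fun p : (a : {a : Fin d → ℤ // normK k a ≤ (lam : ℤ)}) ×
    {v : Fin m → Fin d → ℤ // ∑ i, normK k (v i) = (((lam : ℤ) - normK k a.1).toNat : ℤ)} =>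
      (f (x - p.1.1) : ℝ≥0∞) * ∏ i, (g i (x - p.2.1 i) : ℝ≥0∞)]
  have hsum (u : {u : Fin (m + 1) → Fin d → ℤ // ∑ i, normK k (u i) = (lam : ℤ)}) :
      normK k (u.1 0) + ∑ i, normK k (Fin.tail u.1 i) = lam :=
    (Fin.sum_univ_succ fun i => normK k (u.1 i)).symm.trans u.2
  have htail (u : Fin (m + 1) → Fin d → ℤ) : 0 ≤ ∑ i, normK k (Fin.tail u i) :=
    Finset.sum_nonneg fun _ _ => normK_nonneg _ _
  let φ : {u : Fin (m + 1) → Fin d → ℤ // ∑ i, normK k (u i) = (lam : ℤ)} →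
      (a : {a : Fin d → ℤ // normK k a ≤ (lam : ℤ)}) × {v : Fin m → Fin d → ℤ //
        ∑ i, normK k (v i) = (((lam : ℤ) - normK k a.1).toNat : ℤ)} := fun u =>
    ⟨⟨u.1 0, by linarith [hsum u, htail u.1]⟩, ⟨Fin.tail u.1, by
      rw [Int.toNat_of_nonneg] <;> linarith [hsum u, htail u.1]⟩⟩
  have hφ : Function.Injective φ := fun u w h => by
    have h0 : u.1 0 = w.1 0 := congrArg (fun p => p.1.1) h
    have h1 : Fin.tail u.1 = Fin.tail w.1 := congrArg (fun p => p.2.1) h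
    refine Subtype.ext ?_
    rw [← Fin.cons_self_tail u.1, ← Fin.cons_self_tail w.1, h0, h1]
  refine le_trans (le_of_eq (tsum_congr fun u => ?_)) (ENNReal.tsum_comp_le_tsum_of_injective hφ _)
  rw [Fin.prod_univ_succ]
  rfl

/-- For `k ≥ 2`, `d ≥ 1`, `ℓ = m + 1 ≥ 2` with `(ℓ-1)d = md ≥ k`, and nonnegative functions,
the pointwise bound `T^{k,ℓ,*}(f_1,…,f_ℓ)(x) ≤ M_k f_1(x) · S_k^{ℓ-1}(f_2,…,f_ℓ)(x)`. -/
theorem multilinear_degree_k_pointwise_product_bound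
    (d k m : ℕ) (hk : 2 ≤ k) (hd : 1 ≤ d) (hm : 1 ≤ m) (hmd : k ≤ m * d)
    (f₁ : (Fin d → ℤ) → ℝ≥0) (g : Fin m → (Fin d → ℤ) → ℝ≥0) (x : Fin d → ℤ) :
    multMaxKNN d k (m + 1) (Fin.cons f₁ g) x ≤ hlMaxK d k f₁ x * multSphMaxKNN d k m g x := by
  refine iSup₂_le fun lam hlam => ?_
  have hk0 : k ≠ 0 := by omega
  have hlam0 : (lam : ℝ≥0∞) ≠ 0 := by exact_mod_cast (by omega : lam ≠ 0)
  have hexp : (((m + 1) * d : ℕ) : ℝ) / (k : ℝ) - 1 =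
      (d : ℝ) / k + (((m * d : ℕ) : ℝ) / (k : ℝ) - 1) := by
    push_cast; ring
  rw [ENNReal.inv_natCast_rpow_mul_le_iff hlam, hexp, ENNReal.rpow_add _ _ hlam0 (by simp),
    mul_mul_mul_comm]
  calc _ ≤ _ := tsum_sphere_cons_le f₁ g x
    _ ≤ ∑' a : {a : Fin d → ℤ // normK k a ≤ (lam : ℤ)}, (f₁ (x - a.1) : ℝ≥0∞) *
          ((lam : ℝ≥0∞) ^ (((m * d : ℕ) : ℝ) / (k : ℝ) - 1) * multSphMaxKNN d k m g x) := by
        gcongr with a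
        refine tsum_sphere_le_multSphMaxKNN hk0 hmd hlam ?_ g x
        have := normK_nonneg k a.1
        omega
    _ ≤ _ := by
        rw [ENNReal.tsum_mul_right]
        gcongr
        exact tsum_ball_le_hlMaxK hlam f₁ x
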